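/- Let H be a complex Hilbert space, let E be an effect on H (a selfadjoint continuous linear operator with 0 ≤ re ⟪x, E x⟫ ≤ ‖x‖² for all x), and let φ ∈ H be a unit vector with ⟪φ, E φ⟫ = 1. Then for every ψ ∈ H, re ⟪ψ, E ψ⟫ ≥ |⟪φ, ψ⟫|². In particular, every effect that accepts the pure state φ with certainty accepts any unit vector ψ with probability at least the quantum transition probability |⟪φ, ψ⟫|². -/

import Mathlib

local notation "⟪" x ", " y "⟫" => @inner ℂ _ _ x y

/-- An effect that accepts the unit vector `φ` with certainty accepts every vector `ψ`
with probability at least the quantum transition probability `|⟪φ, ψ⟫|²`. -/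
theorem effect_accepting_certainly_lower_bound
    {H : Type*} [NormedAddCommGroup H] [InnerProductSpace ℂ H] [CompleteSpace H]
    (E : H →L[ℂ] H) (hsa : IsSelfAdjoint E)
    (hE0 : ∀ x : H, 0 ≤ (⟪x, E x⟫).re)
    (hE1 : ∀ x : H, (⟪x, E x⟫).re ≤ ‖x‖ ^ 2)
    (φ : H) (hφ : ‖φ‖ = 1) (hcert : ⟪φ, E φ⟫ = 1) :
    ∀ ψ : H, (⟪ψ, E ψ⟫).re ≥ ‖⟪φ, ψ⟫‖ ^ 2 := by
  intro ψ
  have sym : ∀ x y : H, ⟪E x, y⟫ = ⟪x, E y⟫ := fun x y =>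
    (ContinuousLinearMap.isSelfAdjoint_iff_isSymmetric.mp hsa) x y
  have hm : (⟪E φ, E φ⟫).re = ‖E φ‖ ^ 2 := inner_self_eq_norm_sq (𝕜 := ℂ) (E φ)
  have hφφ : ⟪φ, φ⟫ = 1 := by
    rw [inner_self_eq_norm_sq_to_K, hφ]; simp
  have h1 := hE1 (E φ)
  have h0 := hE0 (φ - E φ)
  have e1 : ⟪φ, E (E φ)⟫ = ⟪E φ, E φ⟫ := (sym _ _).symm
  have e2 : ⟪E φ, φ⟫ = 1 := by rw [sym, hcert]
  simp only [map_sub, inner_sub_left, inner_sub_right, hcert, e1, Complex.sub_re,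
    Complex.one_re, hm] at h0
  have hv : ‖φ - E φ‖ ^ 2 ≤ 0 := by
    have h := inner_self_eq_norm_sq (𝕜 := ℂ) (φ - E φ)
    change (⟪φ - E φ, φ - E φ⟫).re = _ at h
    rw [← h]
    simp only [inner_sub_left, inner_sub_right, hcert, e2, hφφ, Complex.sub_re,
      Complex.one_re, hm]
    linarith
  have hEφ : E φ = φ := by
    have h2 : ‖φ - E φ‖ = 0 := by nlinarith [norm_nonneg (φ - E φ)]
    exact (sub_eq_zero.mp (norm_eq_zero.mp h2)).symm
  have h3 := hE0 (ψ - ⟪φ, ψ⟫ • φ)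
  have e3 : ⟪φ, E ψ⟫ = ⟪φ, ψ⟫ := by rw [← sym, hEφ]
  have e4 : ⟪ψ, φ⟫ = (starRingEnd ℂ) ⟪φ, ψ⟫ := (inner_conj_symm _ _).symm
  simp only [map_sub, map_smul, hEφ, inner_sub_left, inner_sub_right, inner_smul_left,
    inner_smul_right, e3, e4, hφφ] at h3
  rw [Complex.sq_norm, Complex.normSq_apply]
  simp [-inner_conj_symm] at h3
  linarith
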